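/- arXiv:2405.18173 — 4 statements merged into one kernel-verified Lean document; each statement's English description precedes it below -/
import Mathlib

section
/- Let G=(V,E,ω,μ) be a finite connected weighted graph, let p>1, and let ψ:V→[0,∞) with ψ≢0. Then there exists Λ = Λ(p,ψ,G) > 0 such that for every λ>Λ the life span T_λ of the solution of u_t = Δu + u^p, u(·,0)=λψ is finite, and lim_{λ→∞} λ^{p-1} T_λ = 1/((p-1)(max_{V} ψ)^{p-1}). -/
open Filter Topology Set
open scoped ENNReal Classical

noncomputable section

/-- The graph Laplacian `Δu(x) = (1/μ(x)) ∑_y ω(x,y) (u(y) − u(x))`. -/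
def graphLap {V : Type*} (ω : V → V → ℝ) (μ : V → ℝ) (u : V → ℝ) (x : V) : ℝ :=
  (1 / μ x) * ∑' y, ω x y * (u y - u x)

/-- `(V, ω, μ)` is a locally finite connected weighted graph: `ω` is symmetric and
nonnegative (with `ω x y > 0` exactly for neighbours), there are no loops, every
vertex has finitely many neighbours, `μ > 0`, and the graph is connected. -/
structure IsWeightedGraph {V : Type*} (ω : V → V → ℝ) (μ : V → ℝ) : Prop where
  symm : ∀ x y, ω x y = ω y x
  nonneg : ∀ x y, 0 ≤ ω x y
  loopless : ∀ x, ω x x = 0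
  locallyFinite : ∀ x, {y | 0 < ω x y}.Finite
  measurePos : ∀ x, 0 < μ x
  connected : ∀ x y, Relation.ReflTransGen (fun a b => 0 < ω a b) x y

/-- `D_μ = sup_x m(x)/μ(x) < ∞`, where `m(x) = ∑_{y ∼ x} ω(x,y)`. -/
def DmuFinite {V : Type*} (ω : V → V → ℝ) (μ : V → ℝ) : Prop :=
  ∃ C : ℝ, ∀ x, (∑' y, ω x y) ≤ C * μ x

/-- A solution of `u_t = L u + u^p` on `V × [0,T)` with initial datum `ψ0`:
a nonnegative function, continuous in `t` on `[0,T)` for each fixed `x`,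
bounded on `V × [0,T']` for every `T' < T`, differentiable in `t` on `(0,T)`
and satisfying the equation pointwise there. -/
structure IsHeatSol {V : Type*} (L : (V → ℝ) → V → ℝ) (p : ℝ)
    (ψ0 : V → ℝ) (T : ℝ) (u : V → ℝ → ℝ) : Prop where
  nonneg : ∀ x, ∀ t ∈ Ico (0:ℝ) T, 0 ≤ u x t
  cont : ∀ x, ContinuousOn (u x) (Ico (0:ℝ) T)
  bounded : ∀ T' ∈ Ioo (0:ℝ) T, ∃ C : ℝ, ∀ x, ∀ t ∈ Icc (0:ℝ) T', |u x t| ≤ C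
  eqn : ∀ x, ∀ t ∈ Ioo (0:ℝ) T,
    HasDerivAt (u x) (L (fun y => u y t) x + u x t ^ p) t
  init : ∀ x, u x 0 = ψ0 x

/-- The life span `T_λ`: the supremum (in `ℝ≥0∞`) of all `T > 0` such that the
problem has a solution on `[0,T)`. -/
def lifeSpan {V : Type*} (L : (V → ℝ) → V → ℝ) (p : ℝ) (ψ0 : V → ℝ) : ℝ≥0∞ :=
  ⨆ (T : ℝ) (_ : 0 < T ∧ ∃ u, IsHeatSol L p ψ0 T u), ENNReal.ofReal T

section Laplacian

variable {V : Type*} [Fintype V] {ω : V → V → ℝ} {μ : V → ℝ}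

lemma graphLap_eq_sum (u : V → ℝ) (x : V) :
    graphLap ω μ u x = (1 / μ x) * ∑ y, ω x y * (u y - u x) := by
  rw [graphLap, tsum_fintype]

lemma graphLap_sub (u w : V → ℝ) (x : V) :
    graphLap ω μ u x - graphLap ω μ w x = graphLap ω μ (fun y => u y - w y) x := by
  simp only [graphLap_eq_sum, ← mul_sub, ← Finset.sum_sub_distrib]
  congr 1
  exact Finset.sum_congr rfl fun y _ => by ring

/-- On a finite graph the weighted degree `m(x)/μ(x)` is bounded. -/
lemma IsWeightedGraph.exists_degree_le (hG : IsWeightedGraph ω μ) :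
    ∃ D : ℝ, 0 < D ∧ ∀ x, (1 / μ x) * ∑ y, ω x y ≤ D := by
  have hnn : ∀ x, 0 ≤ (1 / μ x) * ∑ y, ω x y := fun x =>
    mul_nonneg (one_div_nonneg.2 (hG.measurePos x).le)
      (Finset.sum_nonneg fun y _ => hG.nonneg x y)
  refine ⟨∑ x, (1 / μ x) * ∑ y, ω x y + 1,
    add_pos_of_nonneg_of_pos (Finset.sum_nonneg fun x _ => hnn x) one_pos, fun x => ?_⟩
  have := Finset.single_le_sum (f := fun x => (1 / μ x) * ∑ y, ω x y)
    (fun x _ => hnn x) (Finset.mem_univ x)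
  linarith

lemma IsWeightedGraph.graphLap_nonneg (hG : IsWeightedGraph ω μ) {u : V → ℝ} {x : V}
    (hu : ∀ y, u x ≤ u y) : 0 ≤ graphLap ω μ u x := by
  rw [graphLap_eq_sum]
  exact mul_nonneg (one_div_nonneg.2 (hG.measurePos x).le)
    (Finset.sum_nonneg fun y _ => mul_nonneg (hG.nonneg x y) (sub_nonneg.2 (hu y)))

lemma IsWeightedGraph.graphLap_nonpos (hG : IsWeightedGraph ω μ) {u : V → ℝ} {x : V}
    (hu : ∀ y, u y ≤ u x) : graphLap ω μ u x ≤ 0 := by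
  rw [graphLap_eq_sum]
  exact mul_nonpos_of_nonneg_of_nonpos (one_div_nonneg.2 (hG.measurePos x).le)
    (Finset.sum_nonpos fun y _ =>
      mul_nonpos_of_nonneg_of_nonpos (hG.nonneg x y) (sub_nonpos.2 (hu y)))

lemma IsWeightedGraph.neg_mul_le_graphLap (hG : IsWeightedGraph ω μ) {D : ℝ} {u : V → ℝ} {x : V}
    (hD : (1 / μ x) * ∑ y, ω x y ≤ D) (hu : ∀ y, 0 ≤ u y) :
    -D * u x ≤ graphLap ω μ u x := by
  have h1 : graphLap ω μ u x
      = (1 / μ x) * ∑ y, ω x y * u y - ((1 / μ x) * ∑ y, ω x y) * u x := by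
    simp only [graphLap_eq_sum, mul_sub, Finset.sum_sub_distrib, mul_assoc, Finset.sum_mul]
  have h2 : 0 ≤ (1 / μ x) * ∑ y, ω x y * u y :=
    mul_nonneg (one_div_nonneg.2 (hG.measurePos x).le)
      (Finset.sum_nonneg fun y _ => mul_nonneg (hG.nonneg x y) (hu y))
  have h3 := mul_le_mul_of_nonneg_right hD (hu x)
  linarith

lemma IsWeightedGraph.abs_graphLap_le (hG : IsWeightedGraph ω μ) {D C : ℝ} {u : V → ℝ} {x : V}
    (hD : (1 / μ x) * ∑ y, ω x y ≤ D) (hu : ∀ y, |u y| ≤ C) :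
    |graphLap ω μ u x| ≤ 2 * D * C := by
  have hμ : 0 ≤ 1 / μ x := one_div_nonneg.2 (hG.measurePos x).le
  have hC : 0 ≤ C := (abs_nonneg _).trans (hu x)
  have hsum : |∑ y, ω x y * (u y - u x)| ≤ (∑ y, ω x y) * (2 * C) := by
    rw [Finset.sum_mul]
    refine (Finset.abs_sum_le_sum_abs _ _).trans (Finset.sum_le_sum fun y _ => ?_)
    rw [abs_mul, abs_of_nonneg (hG.nonneg x y)]
    refine mul_le_mul_of_nonneg_left ?_ (hG.nonneg x y)
    linarith [abs_sub (u y) (u x), hu x, hu y]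
  rw [graphLap_eq_sum, abs_mul, abs_of_nonneg hμ]
  calc (1 / μ x) * |∑ y, ω x y * (u y - u x)|
      ≤ (1 / μ x) * ((∑ y, ω x y) * (2 * C)) := mul_le_mul_of_nonneg_left hsum hμ
    _ = ((1 / μ x) * ∑ y, ω x y) * (2 * C) := by ring
    _ ≤ D * (2 * C) := mul_le_mul_of_nonneg_right hD (by linarith)
    _ = 2 * D * C := by ring

end Laplacian

/-- Truncation of `r` to the interval `[0, b]`. -/
def truncate (b r : ℝ) : ℝ := max 0 (min r b)

lemma truncate_nonneg (b r : ℝ) : 0 ≤ truncate b r := le_max_left _ _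

lemma truncate_le {b : ℝ} (hb : 0 ≤ b) (r : ℝ) : truncate b r ≤ b :=
  max_le hb (min_le_right _ _)

lemma truncate_of_nonpos {b r : ℝ} (hr : r ≤ 0) : truncate b r = 0 :=
  max_eq_left ((min_le_left _ _).trans hr)

lemma truncate_of_ge {b r : ℝ} (hb : 0 ≤ b) (hr : b ≤ r) : truncate b r = b := by
  rw [truncate, min_eq_right hr, max_eq_right hb]

lemma truncate_of_mem {b r : ℝ} (h0 : 0 ≤ r) (hr : r ≤ b) : truncate b r = r := by
  rw [truncate, min_eq_left hr, max_eq_right h0]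

lemma abs_truncate_sub_truncate_le (b r s : ℝ) : |truncate b r - truncate b s| ≤ |r - s| := by
  refine (abs_max_sub_max_le_max _ _ _ _).trans (max_le (by simp) ?_)
  refine (abs_min_sub_min_le_max _ _ _ _).trans (max_le le_rfl (by simp))

lemma abs_rpow_sub_rpow_le {p K r s : ℝ} (hp : 1 ≤ p) (hr : r ∈ Icc 0 K) (hs : s ∈ Icc 0 K) :
    |r ^ p - s ^ p| ≤ p * K ^ (p - 1) * |r - s| := by
  refine Convex.norm_image_sub_le_of_norm_hasDerivWithin_le (f := fun y : ℝ => y ^ p)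
    (f' := fun y => p * y ^ (p - 1)) (s := Icc 0 K)
    (fun y _ => (Real.hasDerivAt_rpow_const (Or.inr hp)).hasDerivWithinAt) (fun y hy => ?_)
    (convex_Icc 0 K) hs hr
  have h : 0 ≤ y ^ (p - 1) := Real.rpow_nonneg hy.1 _
  rw [Real.norm_of_nonneg (by positivity)]
  exact mul_le_mul_of_nonneg_left
    (Real.rpow_le_rpow hy.1 hy.2 (by linarith)) (by linarith)

/-- The reaction–diffusion field `Δu + u^p` evaluated at the truncation of `u` to `[0, b]`. -/
def truncatedField {V : Type*} (ω : V → V → ℝ) (μ : V → ℝ) (p b : ℝ) (u : V → ℝ) (x : V) : ℝ :=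
  graphLap ω μ (fun y => truncate b (u y)) x + truncate b (u x) ^ p

section Existence

variable {V : Type*} [Fintype V] {ω : V → V → ℝ} {μ : V → ℝ} {p : ℝ}

lemma IsWeightedGraph.lipschitzWith_truncatedField (hG : IsWeightedGraph ω μ) {D K b : ℝ}
    (hD0 : 0 < D) (hD : ∀ x, (1 / μ x) * ∑ y, ω x y ≤ D) (hp : 1 ≤ p)
    (hb : 0 ≤ b) (hbK : b ≤ K) :
    LipschitzWith (Real.toNNReal (2 * D + p * K ^ (p - 1))) (truncatedField ω μ p b) := by
  have hK : 0 ≤ K ^ (p - 1) := Real.rpow_nonneg (hb.trans hbK) _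
  have hC : 0 ≤ 2 * D + p * K ^ (p - 1) := by positivity
  have hmem : ∀ r, truncate b r ∈ Icc 0 K := fun r =>
    ⟨truncate_nonneg _ _, (truncate_le hb r).trans hbK⟩
  refine LipschitzWith.of_dist_le_mul fun u w => ?_
  rw [Real.coe_toNNReal _ hC, dist_eq_norm, dist_eq_norm,
    pi_norm_le_iff_of_nonneg (mul_nonneg hC (norm_nonneg _))]
  intro x
  have hcoord : ∀ y, |truncate b (u y) - truncate b (w y)| ≤ ‖u - w‖ := fun y =>
    (abs_truncate_sub_truncate_le _ _ _).trans (norm_le_pi_norm (u - w) y)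
  have h1 := hG.abs_graphLap_le (hD x) hcoord
  have h2 := (abs_rpow_sub_rpow_le hp (hmem (u x)) (hmem (w x))).trans
    (mul_le_mul_of_nonneg_left (hcoord x) (by positivity))
  rw [← graphLap_sub] at h1
  calc ‖(truncatedField ω μ p b u - truncatedField ω μ p b w) x‖
      = |(graphLap ω μ (fun y => truncate b (u y)) x
          - graphLap ω μ (fun y => truncate b (w y)) x)
          + (truncate b (u x) ^ p - truncate b (w x) ^ p)| := by
        rw [Real.norm_eq_abs, Pi.sub_apply, truncatedField, truncatedField]
        congr 1
        ring
    _ ≤ 2 * D * ‖u - w‖ + p * K ^ (p - 1) * ‖u - w‖ :=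
        (abs_add_le _ _).trans (add_le_add h1 h2)
    _ = (2 * D + p * K ^ (p - 1)) * ‖u - w‖ := by ring

lemma IsWeightedGraph.norm_truncatedField_le (hG : IsWeightedGraph ω μ) {D K b : ℝ}
    (hD0 : 0 < D) (hD : ∀ x, (1 / μ x) * ∑ y, ω x y ≤ D) (hp : 1 ≤ p)
    (hb : 0 ≤ b) (hbK : b ≤ K) (u : V → ℝ) :
    ‖truncatedField ω μ p b u‖ ≤ 2 * D * K + K ^ p := by
  have hK0 : 0 ≤ K := hb.trans hbK
  have hK : 0 ≤ K ^ p := Real.rpow_nonneg hK0 _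
  have hle : ∀ r, truncate b r ≤ K := fun r => (truncate_le hb r).trans hbK
  rw [pi_norm_le_iff_of_nonneg (by positivity)]
  intro x
  refine (abs_add_le _ _).trans (add_le_add (hG.abs_graphLap_le (hD x) fun y => ?_) ?_)
  · rw [abs_of_nonneg (truncate_nonneg _ _)]
    exact hle _
  · rw [abs_of_nonneg (Real.rpow_nonneg (truncate_nonneg _ _) _)]
    exact Real.rpow_le_rpow (truncate_nonneg _ _) (hle _) (by linarith)

lemma continuousOn_truncatedField (hp : 1 ≤ p) {v : ℝ → ℝ} {s : Set ℝ}
    (hv : ContinuousOn v s) (u : V → ℝ) :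
    ContinuousOn (fun t => truncatedField ω μ p (v t) u) s := by
  have htr : ∀ y, ContinuousOn (fun t => truncate (v t) (u y)) s := fun y =>
    continuousOn_const.sup (continuousOn_const.inf hv)
  refine continuousOn_pi.2 fun x => ?_
  simp only [truncatedField, graphLap_eq_sum]
  exact (continuousOn_const.mul (continuousOn_finsetSum _ fun y _ =>
    continuousOn_const.mul ((htr y).sub (htr x)))).add
    ((htr x).rpow_const fun _ _ => Or.inr (by linarith))

/-- A bounded spatially constant solution `v` of `v' = v^p` dominating the initial datum yields
a solution of the heat equation on the same time interval. -/
lemma IsWeightedGraph.exists_isHeatSol (hG : IsWeightedGraph ω μ) (hp : 1 ≤ p)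
    {ψ0 : V → ℝ} {v : ℝ → ℝ} {S K : ℝ} (hS : 0 < S)
    (hv : ContinuousOn v (Icc 0 S)) (hv0 : ∀ t ∈ Icc 0 S, 0 ≤ v t) (hvK : ∀ t ∈ Icc 0 S, v t ≤ K)
    (hv' : ∀ t ∈ Ico 0 S, HasDerivWithinAt v (v t ^ p) (Ici t) t)
    (hψ0 : ∀ x, 0 ≤ ψ0 x) (hψv : ∀ x, ψ0 x ≤ v 0) :
    ∃ u, IsHeatSol (graphLap ω μ) p ψ0 S u := by
  obtain ⟨D, hD0, hD⟩ := hG.exists_degree_le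
  have hK0 : 0 ≤ K := (hv0 0 (left_mem_Icc.2 hS.le)).trans (hvK 0 (left_mem_Icc.2 hS.le))
  have hL : 0 ≤ 2 * D * K + K ^ p := by positivity
  have hPL : IsPicardLindelof (fun t => truncatedField ω μ p (v t))
      (⟨0, left_mem_Icc.2 hS.le⟩ : Icc (0 : ℝ) S) ψ0
      (Real.toNNReal ((2 * D * K + K ^ p) * S)) 0 (Real.toNNReal (2 * D * K + K ^ p))
      (Real.toNNReal (2 * D + p * K ^ (p - 1))) :=
    { lipschitzOnWith := fun t ht =>
        (hG.lipschitzWith_truncatedField hD0 hD hp (hv0 t ht) (hvK t ht)).lipschitzOnWith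
      continuousOn := fun u _ => continuousOn_truncatedField hp hv u
      norm_le := fun t ht u _ => by
        rw [Real.coe_toNNReal _ hL]
        exact hG.norm_truncatedField_le hD0 hD hp (hv0 t ht) (hvK t ht) u
      mul_max_le := by
        rw [Real.coe_toNNReal _ hL, Real.coe_toNNReal _ (mul_nonneg hL hS.le)]
        simp [hS.le] }
  obtain ⟨α, hα0, hα⟩ := hPL.exists_eq_forall_mem_Icc_hasDerivWithinAt₀
  have hαx : ∀ x, ∀ t ∈ Icc 0 S, HasDerivWithinAt (fun s => α s x)
      (truncatedField ω μ p (v t) (α t) x) (Icc 0 S) t := fun x t ht =>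
    hasDerivWithinAt_pi.1 (hα t ht) x
  have hcont : ∀ x, ContinuousOn (fun s => α s x) (Icc 0 S) := fun x t ht =>
    (hαx x t ht).continuousWithinAt
  have hright : ∀ x, ∀ t ∈ Ico 0 S, HasDerivWithinAt (fun s => α s x)
      (truncatedField ω μ p (v t) (α t) x) (Ici t) t := fun x t ht =>
    (hαx x t (Ico_subset_Icc_self ht)).mono_of_mem_nhdsWithin
      (mem_of_superset (Icc_mem_nhdsGE ht.2) (Icc_subset_Icc_left ht.1))
  have hbarrier : ∀ ε : ℝ, 0 < ε → ∀ t, 0 ≤ t → 0 < ε * (1 + t) := fun ε hε t ht => by positivity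
  have hlin : ∀ ε t : ℝ, HasDerivAt (fun s => ε * (1 + s)) ε t := fun ε t => by
    simpa using ((hasDerivAt_id t).const_add 1).const_mul ε
  have hlower : ∀ x, ∀ t ∈ Icc 0 S, 0 ≤ α t x := by
    intro x t ht
    have key : ∀ ε : ℝ, 0 < ε → -α t x ≤ ε * (1 + t) := fun ε hε =>
      image_le_of_deriv_right_lt_deriv_boundary' (f := fun s => -α s x)
        (B := fun s => ε * (1 + s)) (B' := fun _ => ε) (hcont x).neg
        (fun s hs => (hright x s hs).neg)
        (by
          have := hψ0 x
          have h0 : α 0 x = ψ0 x := congrFun hα0 x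
          simp only [h0]
          linarith)
        (fun s _ => (hlin ε s).continuousAt.continuousWithinAt)
        (fun s _ => (hlin ε s).hasDerivWithinAt)
        (fun s hs hsB => by
          have hneg : α s x ≤ 0 := by linarith [hbarrier ε hε s hs.1]
          have hlap : 0 ≤ graphLap ω μ (fun y => truncate (v s) (α s y)) x :=
            hG.graphLap_nonneg fun y => by
              rw [truncate_of_nonpos hneg]
              exact truncate_nonneg _ _
          have hpow : 0 ≤ truncate (v s) (α s x) ^ p := Real.rpow_nonneg (truncate_nonneg _ _) _
          rw [truncatedField]
          linarith) ht
    have hlim : 0 < 1 + t := by linarith [ht.1]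
    by_contra! hcon
    have := key (-α t x / (2 * (1 + t))) (div_pos (by linarith) (by linarith))
    have h2 : -α t x / (2 * (1 + t)) * (1 + t) = -α t x / 2 := by field_simp
    linarith
  have hupper : ∀ x, ∀ t ∈ Icc 0 S, α t x ≤ v t := by
    intro x t ht
    have key : ∀ ε : ℝ, 0 < ε → α t x ≤ v t + ε * (1 + t) := fun ε hε =>
      image_le_of_deriv_right_lt_deriv_boundary' (f := fun s => α s x)
        (B := fun s => v s + ε * (1 + s)) (B' := fun s => v s ^ p + ε) (hcont x) (hright x)
        (by
          have := hψv x
          have h0 : α 0 x = ψ0 x := congrFun hα0 x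
          simp only [h0]
          linarith)
        (hv.add fun s _ => (hlin ε s).continuousAt.continuousWithinAt)
        (fun s hs => (hv' s hs).add (hlin ε s).hasDerivWithinAt)
        (fun s hs hsB => by
          have hvs := hv0 s (Ico_subset_Icc_self hs)
          have hge : v s ≤ α s x := by linarith [hbarrier ε hε s hs.1]
          have hlap : graphLap ω μ (fun y => truncate (v s) (α s y)) x ≤ 0 :=
            hG.graphLap_nonpos fun y => by
              rw [truncate_of_ge hvs hge]
              exact truncate_le hvs _
          rw [truncatedField, truncate_of_ge hvs hge]
          linarith) ht
    have hlim : 0 < 1 + t := by linarith [ht.1]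
    by_contra! hcon
    have := key ((α t x - v t) / (2 * (1 + t))) (div_pos (by linarith) (by linarith))
    have h2 : (α t x - v t) / (2 * (1 + t)) * (1 + t) = (α t x - v t) / 2 := by field_simp
    linarith
  refine ⟨fun x t => α t x, ⟨fun x t ht => hlower x t (Ico_subset_Icc_self ht),
    fun x => (hcont x).mono Ico_subset_Icc_self, fun T' hT' => ⟨K, fun x t ht => ?_⟩,
    fun x t ht => ?_, fun x => congrFun hα0 x⟩⟩
  · have ht' : t ∈ Icc 0 S := ⟨ht.1, ht.2.trans hT'.2.le⟩
    rw [abs_of_nonneg (hlower x t ht')]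
    exact (hupper x t ht').trans (hvK t ht')
  · have ht' := Ioo_subset_Icc_self ht
    have htr : ∀ y, truncate (v t) (α t y) = α t y := fun y =>
      truncate_of_mem (hlower y t ht') (hupper y t ht')
    have := (hαx x t ht').hasDerivAt (Icc_mem_nhds ht.1 ht.2)
    simpa only [truncatedField, htr] using this

end Existence

section LifeSpan

variable {V : Type*} [Fintype V] {ω : V → V → ℝ} {μ : V → ℝ} {p : ℝ}

/-- The life span is at least the blow-up time of `v' = v^p`, `v(0) = a`, if `a` bounds the
initial datum. -/
lemma IsWeightedGraph.le_lifeSpan (hG : IsWeightedGraph ω μ) (hp : 1 < p) {ψ0 : V → ℝ} {a : ℝ}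
    (ha : 0 < a) (hψ0 : ∀ x, 0 ≤ ψ0 x) (hψa : ∀ x, ψ0 x ≤ a) :
    ENNReal.ofReal (a ^ (1 - p) / (p - 1)) ≤ lifeSpan (graphLap ω μ) p ψ0 := by
  have hp1 : 0 < p - 1 := by linarith
  have ha' : 0 < a ^ (1 - p) := Real.rpow_pos_of_pos ha _
  have hsub : ∀ S : ℝ, 0 < S → S < a ^ (1 - p) / (p - 1) →
      ENNReal.ofReal S ≤ lifeSpan (graphLap ω μ) p ψ0 := by
    intro S hS hSlt
    rw [lt_div_iff₀ hp1] at hSlt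
    set q : ℝ := -(1 / (p - 1)) with hq
    have hqneg : q < 0 := neg_lt_zero.2 (one_div_pos.2 hp1)
    have hbase : ∀ t ∈ Icc 0 S, a ^ (1 - p) - (p - 1) * S ≤ a ^ (1 - p) - (p - 1) * t :=
      fun t ht => by nlinarith [ht.2]
    have hSpos : 0 < a ^ (1 - p) - (p - 1) * S := by linarith
    have hpos : ∀ t ∈ Icc 0 S, 0 < a ^ (1 - p) - (p - 1) * t := fun t ht =>
      hSpos.trans_le (hbase t ht)
    have hderiv : ∀ t ∈ Icc 0 S, HasDerivAt (fun s => (a ^ (1 - p) - (p - 1) * s) ^ q)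
        (((a ^ (1 - p) - (p - 1) * t) ^ q) ^ p) t := by
      intro t ht
      have h1 : HasDerivAt (fun s => a ^ (1 - p) - (p - 1) * s) (-(p - 1)) t := by
        simpa using ((hasDerivAt_id t).const_mul (p - 1)).const_sub (a ^ (1 - p))
      have h2 := h1.rpow_const (p := q) (Or.inl (hpos t ht).ne')
      convert h2 using 1
      rw [← Real.rpow_mul (hpos t ht).le]
      have e1 : -(p - 1) * q = 1 := by rw [hq]; field_simp
      have e2 : q * p = q - 1 := by linarith
      rw [e1, e2, one_mul]
    have hinit : (a ^ (1 - p) - (p - 1) * 0) ^ q = a := by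
      rw [mul_zero, sub_zero, ← Real.rpow_mul ha.le]
      have : (1 - p) * q = 1 := by rw [hq]; field_simp; ring
      rw [this, Real.rpow_one]
    obtain ⟨u, hu⟩ := hG.exists_isHeatSol (ψ0 := ψ0) hp.le hS
      (v := fun s => (a ^ (1 - p) - (p - 1) * s) ^ q) (K := (a ^ (1 - p) - (p - 1) * S) ^ q)
      (fun t ht => (hderiv t ht).continuousAt.continuousWithinAt)
      (fun t ht => Real.rpow_nonneg (hpos t ht).le _)
      (fun t ht => Real.rpow_le_rpow_of_nonpos hSpos (hbase t ht) hqneg.le)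
      (fun t ht => (hderiv t (Ico_subset_Icc_self ht)).hasDerivWithinAt) hψ0
      (fun x => (hψa x).trans_eq hinit.symm)
    exact le_iSup₂_of_le S ⟨hS, u, hu⟩ le_rfl
  refine le_of_forall_lt fun c hc => ?_
  have hctop : c ≠ ⊤ := hc.ne_top
  obtain ⟨S, hcS, hSlt⟩ := exists_between
    ((ENNReal.lt_ofReal_iff_toReal_lt hctop).1 hc)
  have hSpos : 0 < S := ENNReal.toReal_nonneg.trans_lt hcS
  exact ((ENNReal.lt_ofReal_iff_toReal_lt hctop).2 hcS).trans_le (hsub S hSpos hSlt)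

/-- If `D a^{1-p} < 1`, where `D` bounds the weighted degree at `x₀`, a solution starting
from the value `a` at `x₀` cannot live longer than `a^{1-p} / ((p-1)(1 - D a^{1-p}))`. -/
lemma IsWeightedGraph.lifeSpan_le (hG : IsWeightedGraph ω μ) (hp : 1 < p) {ψ0 : V → ℝ} {a D : ℝ}
    {x₀ : V} (hD0 : 0 < D) (hD : (1 / μ x₀) * ∑ y, ω x₀ y ≤ D) (ha : 0 < a) (hψa : ψ0 x₀ = a)
    (hDa : D * a ^ (1 - p) < 1) :
    lifeSpan (graphLap ω μ) p ψ0
      ≤ ENNReal.ofReal (a ^ (1 - p) / ((p - 1) * (1 - D * a ^ (1 - p)))) := by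
  have hp1 : 0 < p - 1 := by linarith
  refine iSup₂_le fun T ⟨hT, u, hu⟩ => ENNReal.ofReal_le_ofReal (le_of_forall_lt_imp_le_of_dense
    fun t htT => ?_)
  have hrhs : 0 ≤ a ^ (1 - p) / ((p - 1) * (1 - D * a ^ (1 - p))) :=
    div_nonneg (Real.rpow_nonneg ha.le _) (mul_nonneg hp1.le (by linarith))
  rcases le_or_gt t 0 with ht0 | ht0
  · exact ht0.trans hrhs
  have h0mem : (0 : ℝ) ∈ Ico 0 T := ⟨le_rfl, hT⟩
  have htmem : t ∈ Ico 0 T := ⟨ht0.le, htT⟩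
  have hlow : ∀ s ∈ Ioo 0 T, -D * u x₀ s + u x₀ s ^ p
      ≤ graphLap ω μ (fun y => u y s) x₀ + u x₀ s ^ p := fun s hs =>
    add_le_add_left (hG.neg_mul_le_graphLap (u := fun y => u y s) hD
      fun y => hu.nonneg y s (Ioo_subset_Ico_self hs)) _
  have hexp : ∀ c s : ℝ, HasDerivAt (fun r => Real.exp (c * r)) (c * Real.exp (c * s)) s :=
    fun c s => by simpa [mul_comm] using ((hasDerivAt_id s).const_mul c).exp
  have hmono : MonotoneOn (fun s => Real.exp (D * s) * u x₀ s) (Ico 0 T) := by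
    refine monotoneOn_of_hasDerivWithinAt_nonneg (convex_Ico 0 T)
      (f' := fun s => D * Real.exp (D * s) * u x₀ s
        + Real.exp (D * s) * (graphLap ω μ (fun y => u y s) x₀ + u x₀ s ^ p))
      ((by fun_prop : Continuous fun s : ℝ => Real.exp (D * s)).continuousOn.mul (hu.cont x₀))
      (fun s hs => ?_) (fun s hs => ?_) <;> rw [interior_Ico] at hs
    · exact ((hexp D s).mul (hu.eqn x₀ s hs)).hasDerivWithinAt
    · have h1 := hlow s hs
      have h2 : 0 ≤ u x₀ s ^ p := Real.rpow_nonneg (hu.nonneg x₀ s (Ioo_subset_Ico_self hs)) _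
      have h3 : 0 ≤ D * u x₀ s + (graphLap ω μ (fun y => u y s) x₀ + u x₀ s ^ p) := by linarith
      nlinarith [mul_nonneg (Real.exp_pos (D * s)).le h3]
  have hpos : ∀ s ∈ Ico 0 T, 0 < u x₀ s := by
    intro s hs
    have := hmono h0mem hs hs.1
    simp only [mul_zero, Real.exp_zero, one_mul, hu.init, hψa] at this
    exact pos_of_mul_pos_right (ha.trans_le this) (Real.exp_pos _).le
  have hanti : AntitoneOn (fun s => Real.exp (-((p - 1) * D) * s) * (u x₀ s ^ (1 - p) - 1 / D))
      (Ico 0 T) := by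
    refine antitoneOn_of_hasDerivWithinAt_nonpos (convex_Ico 0 T)
      (f' := fun s => -((p - 1) * D) * Real.exp (-((p - 1) * D) * s) * (u x₀ s ^ (1 - p) - 1 / D)
        + Real.exp (-((p - 1) * D) * s) * ((graphLap ω μ (fun y => u y s) x₀ + u x₀ s ^ p)
          * (1 - p) * u x₀ s ^ (1 - p - 1)))
      ((by fun_prop : Continuous fun s : ℝ => Real.exp (-((p - 1) * D) * s)).continuousOn.mul
        (((hu.cont x₀).rpow_const fun s hs => Or.inl (hpos s hs).ne').sub continuousOn_const))
      (fun s hs => ?_) (fun s hs => ?_) <;> rw [interior_Ico] at hs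
    · exact ((hexp _ s).mul (((hu.eqn x₀ s hs).rpow_const
        (Or.inl (hpos s (Ioo_subset_Ico_self hs)).ne')).sub_const _)).hasDerivWithinAt
    · have hus := hpos s (Ioo_subset_Ico_self hs)
      have h1 := mul_le_mul_of_nonneg_right (hlow s hs) (Real.rpow_nonneg hus.le (1 - p - 1))
      have h2 : u x₀ s * u x₀ s ^ (1 - p - 1) = u x₀ s ^ (1 - p) := by
        rw [← Real.rpow_one_add' hus.le (by linarith)]
        ring_nf
      have h3 : u x₀ s ^ p * u x₀ s ^ (1 - p - 1) = 1 := by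
        rw [← Real.rpow_add hus]
        ring_nf
        exact Real.rpow_zero _
      have h4 : -D * u x₀ s ^ (1 - p) + 1
          ≤ (graphLap ω μ (fun y => u y s) x₀ + u x₀ s ^ p) * u x₀ s ^ (1 - p - 1) := by
        calc -D * u x₀ s ^ (1 - p) + 1
            = (-D * u x₀ s + u x₀ s ^ p) * u x₀ s ^ (1 - p - 1) := by
              rw [add_mul, h3, mul_assoc, h2]
          _ ≤ _ := h1
      have h5 := mul_le_mul_of_nonneg_left h4
        (mul_nonneg hp1.le (Real.exp_pos (-((p - 1) * D) * s)).le)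
      have h6 : D * (1 / D) = 1 := mul_one_div_cancel hD0.ne'
      linear_combination h5 + (p - 1) * Real.exp (-((p - 1) * D) * s) * h6
  have hE : 1 - D * a ^ (1 - p) < Real.exp (-((p - 1) * D) * t) := by
    have h1 := hanti h0mem htmem ht0.le
    simp only [mul_zero, Real.exp_zero, one_mul, hu.init, hψa] at h1
    have h2 := mul_pos (Real.exp_pos (-((p - 1) * D) * t))
      (Real.rpow_pos_of_pos (hpos t htmem) (1 - p))
    have h3 : 0 < D * (a ^ (1 - p) - 1 / D + Real.exp (-((p - 1) * D) * t) * (1 / D)) :=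
      mul_pos hD0 (by linarith)
    have h4 : D * (1 / D) = 1 := mul_one_div_cancel hD0.ne'
    linear_combination h3 + (Real.exp (-((p - 1) * D) * t) - 1) * h4
  have hs : 0 < 1 - D * a ^ (1 - p) := by linarith
  have hlog := (Real.log_lt_iff_lt_exp hs).2 hE
  have hlog' := Real.one_sub_inv_le_log_of_pos hs
  have hfin : (p - 1) * D * t ≤ (1 - D * a ^ (1 - p))⁻¹ - 1 := by linarith
  have hmul := mul_le_mul_of_nonneg_right hfin hs.le
  rw [sub_one_mul (1 - D * a ^ (1 - p))⁻¹, inv_mul_cancel₀ hs.ne'] at hmul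
  rw [le_div_iff₀ (mul_pos hp1 hs)]
  refine le_of_mul_le_mul_left ?_ hD0
  linarith

end LifeSpan

/-- Theorem 1.7(1): on a finite connected weighted graph, there is `Λ > 0`
such that `T_λ < ∞` for `λ > Λ`, and
`lim_{λ→∞} λ^{p-1} T_λ = 1/((p-1)(max_V ψ)^{p-1})`. -/
theorem stmt5 {V : Type*} [Fintype V] [Nonempty V]
    (ω : V → V → ℝ) (μ : V → ℝ) (hG : IsWeightedGraph ω μ)
    (p : ℝ) (hp : 1 < p)
    (ψ : V → ℝ) (hψ0 : ∀ x, 0 ≤ ψ x) (hψne : ∃ x, ψ x ≠ 0) :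
    ∃ Λ : ℝ, 0 < Λ ∧
      (∀ lam : ℝ, Λ < lam →
        lifeSpan (graphLap ω μ) p (fun x => lam * ψ x) < ⊤) ∧
      Tendsto
        (fun lam : ℝ => ENNReal.ofReal (lam ^ (p - 1)) *
          lifeSpan (graphLap ω μ) p (fun x => lam * ψ x))
        atTop
        (𝓝 (ENNReal.ofReal (1 / ((p - 1) * (⨆ x, ψ x) ^ (p - 1))))) := by
  obtain ⟨D, hD0, hD⟩ := hG.exists_degree_le
  have hp1 : 0 < p - 1 := by linarith
  obtain ⟨x₀, hx₀⟩ := exists_eq_ciSup_of_finite (f := ψ)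
  set M : ℝ := ⨆ x, ψ x with hM
  have hle : ∀ x, ψ x ≤ M := le_ciSup (Set.finite_range ψ).bddAbove
  have hMpos : 0 < M := by
    obtain ⟨x, hx⟩ := hψne
    exact ((hψ0 x).lt_of_ne' hx).trans_le (hle x)
  have hsmall : Tendsto (fun lam : ℝ => D * (lam * M) ^ (1 - p)) atTop (𝓝 0) := by
    have h1 : Tendsto (fun lam : ℝ => (lam * M) ^ (-(p - 1))) atTop (𝓝 0) :=
      (tendsto_rpow_neg_atTop hp1).comp (tendsto_id.atTop_mul_const hMpos)
    simpa using h1.const_mul D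
  have hupper : ∀ lam : ℝ, 0 < lam → D * (lam * M) ^ (1 - p) < 1 →
      lifeSpan (graphLap ω μ) p (fun x => lam * ψ x) ≤ ENNReal.ofReal
        ((lam * M) ^ (1 - p) / ((p - 1) * (1 - D * (lam * M) ^ (1 - p)))) := fun lam hlam h =>
    hG.lifeSpan_le hp hD0 (hD x₀) (mul_pos hlam hMpos) (by simp only [hx₀]) h
  have hscale : ∀ lam : ℝ, 0 < lam → lam ^ (p - 1) * (lam * M) ^ (1 - p) = M ^ (1 - p) := by
    intro lam hlam
    rw [Real.mul_rpow hlam.le hMpos.le, ← mul_assoc, ← Real.rpow_add hlam]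
    simp
  have hMeq : 1 / ((p - 1) * M ^ (p - 1)) = M ^ (1 - p) / (p - 1) := by
    rw [← neg_sub p 1, Real.rpow_neg hMpos.le]
    field_simp
  obtain ⟨Λ, hΛ⟩ := eventually_atTop.1 (hsmall.eventually_lt_const one_pos)
  have hΛ' : ∀ lam, max Λ 1 < lam → 0 < lam ∧ D * (lam * M) ^ (1 - p) < 1 := fun lam h =>
    ⟨one_pos.trans ((le_max_right _ _).trans_lt h), hΛ lam ((le_max_left _ _).trans h.le)⟩
  refine ⟨max Λ 1, one_pos.trans_le (le_max_right _ _), fun lam hlam => ?_, ?_⟩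
  · exact (hupper lam (hΛ' lam hlam).1 (hΛ' lam hlam).2).trans_lt ENNReal.ofReal_lt_top
  · have hlim : Tendsto (fun lam : ℝ => ENNReal.ofReal
        (M ^ (1 - p) / ((p - 1) * (1 - D * (lam * M) ^ (1 - p))))) atTop
        (𝓝 (ENNReal.ofReal (M ^ (1 - p) / (p - 1)))) := by
      refine ENNReal.tendsto_ofReal ?_
      have h1 := ((hsmall.const_sub 1).const_mul (p - 1))
      rw [sub_zero, mul_one] at h1
      exact tendsto_const_nhds.div h1 hp1.ne'
    rw [hMeq]
    refine tendsto_of_tendsto_of_tendsto_of_le_of_le' tendsto_const_nhds hlim ?_ ?_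
    · filter_upwards [eventually_gt_atTop 0] with lam hlam
      have h1 := hG.le_lifeSpan hp (mul_pos hlam hMpos) (ψ0 := fun x => lam * ψ x)
        (fun x => mul_nonneg hlam.le (hψ0 x)) (fun x => mul_le_mul_of_nonneg_left (hle x) hlam.le)
      calc ENNReal.ofReal (M ^ (1 - p) / (p - 1))
          = ENNReal.ofReal (lam ^ (p - 1)) * ENNReal.ofReal ((lam * M) ^ (1 - p) / (p - 1)) := by
            rw [← ENNReal.ofReal_mul (Real.rpow_nonneg hlam.le _), ← mul_div_assoc,
              hscale lam hlam]
        _ ≤ _ := by gcongr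
    · filter_upwards [eventually_gt_atTop (max Λ 1)] with lam hlam
      obtain ⟨hpos, hlt⟩ := hΛ' lam hlam
      calc ENNReal.ofReal (lam ^ (p - 1)) * lifeSpan (graphLap ω μ) p (fun x => lam * ψ x)
          ≤ ENNReal.ofReal (lam ^ (p - 1)) * ENNReal.ofReal
            ((lam * M) ^ (1 - p) / ((p - 1) * (1 - D * (lam * M) ^ (1 - p)))) := by
            gcongr
            exact hupper lam hpos hlt
        _ = _ := by
            rw [← ENNReal.ofReal_mul (Real.rpow_nonneg hpos.le _), ← mul_div_assoc,
              hscale lam hpos]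
end
end

section
/- Let G=(V,E,ω,μ) be a finite connected weighted graph, let p>1, and let ψ:V→[0,∞) with min_{x∈V} ψ(x) > 0. Then the life span T_λ of the solution of u_t = Δu + u^p, u(·,0)=λψ is finite for every λ>0. -/
open Filter Topology Set
open scoped ENNReal Classical

noncomputable section

/-- Blow-up bound for the differential inequality `f' ≥ f ^ p` with `f 0 > 0`. -/
theorem le_of_rpow_le_deriv {p T : ℝ} (hp : 1 < p) (hT : 0 < T) {f f' : ℝ → ℝ}
    (hf : ContinuousOn f (Ico 0 T)) (hnn : ∀ t ∈ Ico 0 T, 0 ≤ f t)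
    (hderiv : ∀ t ∈ Ioo 0 T, HasDerivAt f (f' t) t)
    (hle : ∀ t ∈ Ioo 0 T, f t ^ p ≤ f' t) (h0 : 0 < f 0) :
    T ≤ f 0 ^ (1 - p) / (p - 1) := by
  have hp1 : 0 < p - 1 := by linarith
  have hmem0 : (0 : ℝ) ∈ Ico 0 T := ⟨le_rfl, hT⟩
  have hmono : MonotoneOn f (Ico 0 T) := by
    apply monotoneOn_of_deriv_nonneg (convex_Ico 0 T) hf
    · rw [interior_Ico]
      exact fun t ht => (hderiv t ht).differentiableAt.differentiableWithinAt
    · rw [interior_Ico]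
      intro t ht
      rw [(hderiv t ht).deriv]
      exact (Real.rpow_nonneg (hnn t ⟨ht.1.le, ht.2⟩) p).trans (hle t ht)
  have hpos : ∀ t ∈ Ico 0 T, 0 < f t := fun t ht => h0.trans_le (hmono hmem0 ht ht.1)
  have hG : ∀ t ∈ Ioo 0 T, HasDerivAt (fun s => f s ^ (1 - p) + (p - 1) * s)
      (f' t * (1 - p) * f t ^ (1 - p - 1) + (p - 1) * 1) t := fun t ht =>
    ((hderiv t ht).rpow_const (Or.inl (hpos t ⟨ht.1.le, ht.2⟩).ne')).add
      ((hasDerivAt_id t).const_mul (p - 1))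
  have hanti : AntitoneOn (fun s => f s ^ (1 - p) + (p - 1) * s) (Ico 0 T) := by
    apply antitoneOn_of_deriv_nonpos (convex_Ico 0 T)
    · exact (hf.rpow_const fun t ht => Or.inl (hpos t ht).ne').add (by fun_prop)
    · rw [interior_Ico]
      exact fun t ht => (hG t ht).differentiableAt.differentiableWithinAt
    · rw [interior_Ico]
      intro t ht
      rw [(hG t ht).deriv]
      have hft := hpos t ⟨ht.1.le, ht.2⟩
      have hone : 1 ≤ f' t * f t ^ (1 - p - 1) := by
        calc (1 : ℝ) = f t ^ p * f t ^ (1 - p - 1) := by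
              rw [← Real.rpow_add hft]; simp
          _ ≤ _ := by gcongr; exact hle t ht
      nlinarith
  refine le_of_forall_lt fun t ht => ?_
  by_cases ht0 : 0 ≤ t
  · have h := hanti hmem0 ⟨ht0, ht⟩ ht0
    have hft := Real.rpow_pos_of_pos (hpos t ⟨ht0, ht⟩) (1 - p)
    rw [lt_div_iff₀ hp1]
    simp only [mul_zero, add_zero] at h
    linarith
  · have := div_pos (Real.rpow_pos_of_pos h0 (1 - p)) hp1
    linarith

/-- The total mass of the graph Laplacian vanishes on a finite graph. -/
theorem sum_mul_graphLap {V : Type*} [Fintype V] {ω : V → V → ℝ} {μ : V → ℝ}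
    (hG : IsWeightedGraph ω μ) (u : V → ℝ) : ∑ x, μ x * graphLap ω μ u x = 0 := by
  have h1 : ∀ x, μ x * graphLap ω μ u x = ∑ y, ω x y * (u y - u x) := fun x => by
    rw [graphLap, tsum_fintype, ← mul_assoc, mul_one_div_cancel (hG.measurePos x).ne', one_mul]
  simp only [h1]
  have h2 : ∑ x, ∑ y, ω x y * (u y - u x) = -∑ x, ∑ y, ω x y * (u y - u x) := by
    conv_lhs => rw [Finset.sum_comm]
    simp only [← Finset.sum_neg_distrib]
    refine Finset.sum_congr rfl fun x _ => Finset.sum_congr rfl fun y _ => ?_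
    rw [hG.symm y x]
    ring
  linarith

/-- Theorem 1.7(2): on a finite connected weighted graph, if `min_V ψ > 0`
then `T_λ < ∞` for every `λ > 0`. -/
theorem stmt6 {V : Type*} [Fintype V] [Nonempty V]
    (ω : V → V → ℝ) (μ : V → ℝ) (hG : IsWeightedGraph ω μ)
    (p : ℝ) (hp : 1 < p)
    (ψ : V → ℝ) (hψ0 : ∀ x, 0 ≤ ψ x) (hmin : 0 < ⨅ x, ψ x) :
    ∀ lam : ℝ, 0 < lam → lifeSpan (graphLap ω μ) p (fun x => lam * ψ x) < ⊤ := by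
  intro lam hlam
  set S := ∑ x, μ x with hS
  have hSpos : 0 < S := Finset.sum_pos (fun x _ => hG.measurePos x) Finset.univ_nonempty
  have hw : ∀ x, 0 < μ x / S := fun x => div_pos (hG.measurePos x) hSpos
  have hw1 : ∑ x, μ x / S = 1 := by rw [← Finset.sum_div, div_self hSpos.ne']
  have hψpos : ∀ x, 0 < ψ x := fun x =>
    hmin.trans_le (ciInf_le (Set.finite_range ψ).bddBelow x)
  refine lt_of_le_of_lt (iSup₂_le ?_)
    (ENNReal.ofReal_lt_top (r := (∑ x, μ x / S * (lam * ψ x)) ^ (1 - p) / (p - 1)))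
  rintro T ⟨hT, u, hu⟩
  apply ENNReal.ofReal_le_ofReal
  have key := le_of_rpow_le_deriv (f := fun t => ∑ x, μ x / S * u x t)
    (f' := fun t => ∑ x, μ x / S * u x t ^ p) hp hT
    (continuousOn_finsetSum _ fun x _ => continuousOn_const.mul (hu.cont x))
    (fun t ht => Finset.sum_nonneg fun x _ => mul_nonneg (hw x).le (hu.nonneg x t ht))
    (fun t ht => ?_)
    (fun t ht => Real.rpow_arith_mean_le_arith_mean_rpow _ _ _ (fun x _ => (hw x).le) hw1
      (fun x _ => hu.nonneg x t ⟨ht.1.le, ht.2⟩) hp.le)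
    ?_
  · simpa only [hu.init] using key
  · have hd := HasDerivAt.fun_sum (u := Finset.univ) fun x _ =>
      (hu.eqn x t ht).const_mul (μ x / S)
    refine hd.congr_deriv ?_
    simp only [mul_add, Finset.sum_add_distrib, div_mul_eq_mul_div]
    rw [← Finset.sum_div, ← Finset.sum_div, sum_mul_graphLap hG, zero_div, zero_add]
  · simp only [hu.init]
    exact Finset.sum_pos (fun x _ => mul_pos (hw x) (mul_pos hlam (hψpos x)))
      Finset.univ_nonempty
end
end

section
/- Let p>1 and let ψ:ℤ→[0,∞) be bounded with ψ≢0. If max{ liminf_{x→+∞} ψ(x), liminf_{x→−∞} ψ(x) } > 0, then the solution of u_t = Δ_ℤ u + u^p on ℤ×(0,T), u(·,0)=ψ, blows up in finite time, and its life span T₁ satisfies T₁ ≤ (1/(p-1)) · ( max{ liminf_{x→+∞} ψ(x), liminf_{x→−∞} ψ(x) } )^{1-p}. -/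
open Filter Topology Set
open scoped ENNReal Classical

noncomputable section

/-- The graph Laplacian of the one-dimensional lattice `ℤ`:
`Δ_ℤ u(x) = u(x+1) + u(x−1) − 2u(x)`. -/
def zLap (u : ℤ → ℝ) (x : ℤ) : ℝ := u (x + 1) + u (x - 1) - 2 * u x

/-- The tent function of half-width `L` centred at the origin of `ℤ`. -/
def tent (L : ℕ) (x : ℤ) : ℝ := max 0 ((L : ℝ) - |(x : ℝ)|)

lemma tent_nonneg (L : ℕ) (x : ℤ) : 0 ≤ tent L x := le_max_left _ _

lemma tent_eq_zero {L : ℕ} {x : ℤ} (hx : (L : ℤ) ≤ |x|) : tent L x = 0 := by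
  have h : (L : ℝ) ≤ |(x : ℝ)| := by exact_mod_cast hx
  exact max_eq_left (by linarith)

lemma tent_zero (L : ℕ) : tent L 0 = L := by simp [tent]

lemma mem_Icc_of_tent_ne_zero {L : ℕ} {x : ℤ} (hx : tent L x ≠ 0) :
    x ∈ Finset.Icc (-(L : ℤ)) L := by
  by_contra h
  refine hx (tent_eq_zero ?_)
  by_contra! h'
  exact h (Finset.mem_Icc.2 (abs_le.1 h'.le))

/-- The tent function is a subsolution of the eigenvalue equation `Δ w = -(2 / L) w`. -/
lemma neg_mul_tent_le_zLap_tent {L : ℕ} (hL : 0 < L) (x : ℤ) :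
    -(2 / L) * tent L x ≤ zLap (tent L) x := by
  have hL' : (0 : ℝ) < L := by exact_mod_cast hL
  rcases eq_or_ne x 0 with rfl | hx
  · rw [zLap, tent_zero]
    have h1 : (L : ℝ) - 1 ≤ tent L (0 + 1) :=
      le_trans (by simp) (le_max_right _ _)
    have h2 : (L : ℝ) - 1 ≤ tent L (0 - 1) :=
      le_trans (by simp) (le_max_right _ _)
    have h3 : -(2 / (L : ℝ)) * L = -2 := by field_simp
    rw [h3]
    linarith
  · have h0 : -(2 / (L : ℝ)) * tent L x ≤ 0 := by
      have := mul_nonneg (by positivity : (0 : ℝ) ≤ 2 / L) (tent_nonneg L x)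
      linarith
    refine h0.trans ?_
    have hsum : |((x + 1 : ℤ) : ℝ)| + |((x - 1 : ℤ) : ℝ)| = 2 * |(x : ℝ)| := by
      have : |x + 1| + |x - 1| = 2 * |x| := by
        rcases lt_or_gt_of_ne hx with h | h
        · rw [abs_of_nonpos (by omega), abs_of_nonpos (by omega), abs_of_neg h]; ring
        · rw [abs_of_nonneg (by omega), abs_of_nonneg (by omega), abs_of_pos h]; ring
      exact_mod_cast this
    have h1 : (L : ℝ) - |((x + 1 : ℤ) : ℝ)| ≤ tent L (x + 1) := le_max_right _ _
    have h2 : (L : ℝ) - |((x - 1 : ℤ) : ℝ)| ≤ tent L (x - 1) := le_max_right _ _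
    have h3 := tent_nonneg L (x + 1)
    have h4 := tent_nonneg L (x - 1)
    have h5 : tent L x ≤ (tent L (x + 1) + tent L (x - 1)) / 2 :=
      max_le (by linarith) (by linarith)
    rw [zLap]
    linarith

/-- Summation by parts on `ℤ` for a finitely supported weight. -/
lemma tsum_mul_zLap {w : ℤ → ℝ} (hw : w.support.Finite) (u : ℤ → ℝ) :
    ∑' x, w x * zLap u x = ∑' x, zLap w x * u x := by
  have hs : ∀ (e : ℤ ≃ ℤ) (g : ℤ → ℝ), Summable fun x => w (e x) * g x := by
    intro e g
    refine summable_of_hasFiniteSupport ((hw.preimage e.injective.injOn).subset ?_)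
    intro x hx
    exact left_ne_zero_of_mul hx
  have h0 := hs (Equiv.refl ℤ)
  have hp := hs (Equiv.addRight 1)
  have hm := hs (Equiv.subRight 1)
  simp only [Equiv.refl_apply, Equiv.coe_addRight, Equiv.subRight_apply] at h0 hp hm
  have e1 : ∑' x, w x * u (x + 1) = ∑' x, w (x - 1) * u x := by
    rw [← (Equiv.subRight (1 : ℤ)).tsum_eq]; simp
  have e2 : ∑' x, w x * u (x - 1) = ∑' x, w (x + 1) * u x := by
    rw [← (Equiv.addRight (1 : ℤ)).tsum_eq]; simp
  calc ∑' x, w x * zLap u x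
      = ∑' x, (w x * u (x + 1) + w x * u (x - 1) - 2 * (w x * u x)) :=
        tsum_congr fun x => by rw [zLap]; ring
    _ = ∑' x, (w (x + 1) * u x + w (x - 1) * u x - 2 * (w x * u x)) := by
        rw [((h0 _).add (h0 _)).tsum_sub ((h0 _).mul_left 2), (h0 _).tsum_add (h0 _),
          ((hp _).add (hm _)).tsum_sub ((h0 _).mul_left 2), (hp _).tsum_add (hm _), e1, e2]
        ring
    _ = ∑' x, zLap w x * u x := tsum_congr fun x => by rw [zLap]; ring

lemma tent_support_finite (L : ℕ) : (tent L).support.Finite :=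
  (Finset.finite_toSet (Finset.Icc (-(L : ℤ)) L)).subset fun _ hx => mem_Icc_of_tent_ne_zero hx

lemma neg_mul_sum_tent_le {L : ℕ} (hL : 0 < L) {u : ℤ → ℝ} (hu : ∀ x, 0 ≤ u x) :
    -(2 / L) * ∑ x ∈ Finset.Icc (-(L : ℤ)) L, tent L x * u x ≤
      ∑ x ∈ Finset.Icc (-(L : ℤ)) L, tent L x * zLap u x := by
  have key : ∀ g : ℤ → ℝ, ∑ x ∈ Finset.Icc (-(L : ℤ)) L, tent L x * g x =
      ∑' x, tent L x * g x := by
    intro g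
    refine (tsum_eq_sum fun x hx => ?_).symm
    rw [not_not.1 fun h => hx (mem_Icc_of_tent_ne_zero h), zero_mul]
  have hfin : ∀ e : ℤ ≃ ℤ, (fun x => tent L (e x)).support.Finite := fun e =>
    (tent_support_finite L).preimage e.injective.injOn
  rw [key, key, tsum_mul_zLap (tent_support_finite L), ← tsum_mul_left]
  refine Summable.tsum_le_tsum (fun x => ?_) ?_ ?_
  · rw [← mul_assoc]
    exact mul_le_mul_of_nonneg_right (neg_mul_tent_le_zLap_tent hL x) (hu x)
  · refine (summable_of_hasFiniteSupport ((tent_support_finite L).subset ?_)).mul_left _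
    exact fun x hx => left_ne_zero_of_mul hx
  · refine summable_of_hasFiniteSupport ((((hfin (Equiv.addRight 1)).union
      (hfin (Equiv.subRight 1))).union (tent_support_finite L)).subset ?_)
    intro x hx
    by_contra h
    simp only [mem_union, Function.mem_support, not_or, not_not, Equiv.coe_addRight,
      Equiv.subRight_apply] at h
    exact hx (by simp [zLap, h])

/-- A function satisfying `F' ≥ F ^ p - ε F` and `F 0 ≥ c > 0` on `[0, T)` forces `T` to be
bounded. -/
lemma mul_le_of_bernoulli_inequality {p ε c T : ℝ} (hp : 1 < p) (hε : 0 ≤ ε) (hc : 0 < c)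
    (hT : 0 < T) {F F' : ℝ → ℝ} (hF : ContinuousOn F (Ico 0 T))
    (hF0 : ∀ t ∈ Ico 0 T, 0 ≤ F t)
    (hd : ∀ t ∈ Ioo 0 T, HasDerivAt F (F' t) t)
    (hle : ∀ t ∈ Ioo 0 T, F t ^ p - ε * F t ≤ F' t) (hinit : c ≤ F 0) :
    T * (p - 1) ≤ Real.exp (ε * (p - 1) * T) * c ^ (1 - p) := by
  set K : ℝ → ℝ := fun t => Real.exp (ε * t) * F t with hK
  have h0mem : (0 : ℝ) ∈ Ico 0 T := ⟨le_rfl, hT⟩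
  have hKc : ContinuousOn K (Ico 0 T) := by
    refine ContinuousOn.mul ?_ hF
    fun_prop
  have hKd : ∀ t ∈ Ioo 0 T, HasDerivAt K (Real.exp (ε * t) * (ε * F t + F' t)) t := by
    intro t ht
    have h1 : HasDerivAt (fun t => Real.exp (ε * t)) (Real.exp (ε * t) * (ε * 1)) t :=
      ((hasDerivAt_id t).const_mul ε).exp
    exact (h1.mul (hd t ht)).congr_deriv (by ring)
  have hKlow : ∀ t ∈ Ioo 0 T,
      Real.exp (ε * t) * F t ^ p ≤ Real.exp (ε * t) * (ε * F t + F' t) := by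
    intro t ht
    have := hle t ht
    gcongr
    linarith
  have hKmono : MonotoneOn K (Ico 0 T) := by
    refine monotoneOn_of_deriv_nonneg (convex_Ico 0 T) hKc ?_ ?_
    · rw [interior_Ico]
      exact fun t ht => (hKd t ht).differentiableAt.differentiableWithinAt
    · rw [interior_Ico]
      intro t ht
      rw [(hKd t ht).deriv]
      exact le_trans (mul_nonneg (Real.exp_pos _).le
        (Real.rpow_nonneg (hF0 t (Ioo_subset_Ico_self ht)) p)) (hKlow t ht)
  have hK0 : c ≤ K 0 := by simpa [hK] using hinit
  have hKpos : ∀ t ∈ Ico 0 T, 0 < K t := fun t ht =>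
    (hc.trans_le hK0).trans_le (hKmono h0mem ht ht.1)
  set a : ℝ := Real.exp (-(ε * (p - 1) * T)) with ha
  have hKlow' : ∀ t ∈ Ioo 0 T, a * K t ^ p ≤ Real.exp (ε * t) * (ε * F t + F' t) := by
    intro t ht
    refine le_trans ?_ (hKlow t ht)
    have hFt := hF0 t (Ioo_subset_Ico_self ht)
    rw [hK, Real.mul_rpow (Real.exp_pos _).le hFt, ← Real.exp_mul, ← mul_assoc, ha,
      ← Real.exp_add]
    refine mul_le_mul_of_nonneg_right (Real.exp_le_exp.2 ?_) (Real.rpow_nonneg hFt p)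
    have : ε * (p - 1) * t ≤ ε * (p - 1) * T :=
      mul_le_mul_of_nonneg_left ht.2.le (mul_nonneg hε (by linarith))
    nlinarith
  set H : ℝ → ℝ := fun t => K t ^ (1 - p) + (p - 1) * a * t with hH
  have hHd : ∀ t ∈ Ioo 0 T, HasDerivAt H
      (Real.exp (ε * t) * (ε * F t + F' t) * (1 - p) * K t ^ (1 - p - 1) + (p - 1) * a) t := by
    intro t ht
    have h1 := (hKd t ht).rpow_const (p := 1 - p)
      (Or.inl (hKpos t (Ioo_subset_Ico_self ht)).ne')
    have h2 : HasDerivAt (fun t => (p - 1) * a * t) ((p - 1) * a * 1) t :=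
      (hasDerivAt_id t).const_mul _
    exact (h1.add h2).congr_deriv (by ring)
  have hHanti : AntitoneOn H (Ico 0 T) := by
    refine antitoneOn_of_deriv_nonpos (convex_Ico 0 T) ?_ ?_ ?_
    · refine ContinuousOn.add (hKc.rpow_const fun t ht => Or.inl (hKpos t ht).ne') ?_
      fun_prop
    · rw [interior_Ico]
      exact fun t ht => (hHd t ht).differentiableAt.differentiableWithinAt
    · rw [interior_Ico]
      intro t ht
      rw [(hHd t ht).deriv]
      have hpos := hKpos t (Ioo_subset_Ico_self ht)
      have h1 : K t ^ p * K t ^ (1 - p - 1) = 1 := by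
        rw [← Real.rpow_add hpos]; simp
      have h2 : a ≤ Real.exp (ε * t) * (ε * F t + F' t) * K t ^ (1 - p - 1) := by
        calc a = a * K t ^ p * K t ^ (1 - p - 1) := by rw [mul_assoc, h1, mul_one]
          _ ≤ _ := mul_le_mul_of_nonneg_right (hKlow' t ht) (Real.rpow_nonneg hpos.le _)
      nlinarith
  have hbound : ∀ t ∈ Ico 0 T, (p - 1) * a * t ≤ c ^ (1 - p) := by
    intro t ht
    have h1 : H t ≤ H 0 := hHanti h0mem ht ht.1
    have h2 : K 0 ^ (1 - p) ≤ c ^ (1 - p) :=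
      Real.rpow_le_rpow_of_nonpos hc hK0 (by linarith)
    have h3 : 0 ≤ K t ^ (1 - p) := Real.rpow_nonneg (hKpos t ht).le _
    simp only [hH, mul_zero, add_zero] at h1
    linarith
  have hlim : (p - 1) * a * T ≤ c ^ (1 - p) := by
    have htend : Tendsto (fun t => (p - 1) * a * t) (𝓝[<] T) (𝓝 ((p - 1) * a * T)) :=
      (tendsto_id.mono_left nhdsWithin_le_nhds).const_mul _
    refine le_of_tendsto htend ?_
    filter_upwards [Ioo_mem_nhdsLT hT] with t ht using hbound t (Ioo_subset_Ico_self ht)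
  have hone : Real.exp (ε * (p - 1) * T) * a = 1 := by rw [ha, ← Real.exp_add]; simp
  calc T * (p - 1) = Real.exp (ε * (p - 1) * T) * ((p - 1) * a * T) := by
        linear_combination (-(T * (p - 1))) * hone
    _ ≤ _ := mul_le_mul_of_nonneg_left hlim (Real.exp_pos _).le

/-- If the initial datum is at least `c` on an interval of half-width `L`, then the existence time
of any solution is bounded in terms of `c` and `L`. -/
lemma IsHeatSol.mul_le_of_le_init {p c T : ℝ} (hp : 1 < p) (hc : 0 < c) (hT : 0 < T)
    {ψ : ℤ → ℝ} {u : ℤ → ℝ → ℝ} (hu : IsHeatSol zLap p ψ T u) {L : ℕ} (hL : 0 < L) {N : ℤ}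
    (hN : ∀ x ∈ Finset.Icc (-(L : ℤ)) L, c ≤ ψ (N + x)) :
    T * (p - 1) ≤ Real.exp (2 / L * (p - 1) * T) * c ^ (1 - p) := by
  set s := Finset.Icc (-(L : ℤ)) L with hs
  set S := ∑ x ∈ s, tent L x with hS
  have hSpos : 0 < S := by
    refine Finset.sum_pos' (fun x _ => tent_nonneg L x) ⟨0, by simp [hs], ?_⟩
    rw [tent_zero]
    exact_mod_cast hL
  have hw1 : ∑ x ∈ s, tent L x / S = 1 := by
    rw [← Finset.sum_div, div_self hSpos.ne']
  have hw0 : ∀ x ∈ s, 0 ≤ tent L x / S := fun x _ => div_nonneg (tent_nonneg L x) hSpos.le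
  refine mul_le_of_bernoulli_inequality (ε := 2 / L) hp (by positivity) hc hT
    (F := fun t => ∑ x ∈ s, tent L x / S * u (N + x) t)
    (F' := fun t => ∑ x ∈ s, tent L x / S *
      (zLap (fun y => u y t) (N + x) + u (N + x) t ^ p)) ?_ ?_ ?_ ?_ ?_
  · exact continuousOn_finsetSum _ fun x _ => (hu.cont (N + x)).const_mul _
  · exact fun t ht => Finset.sum_nonneg fun x hx => mul_nonneg (hw0 x hx) (hu.nonneg _ t ht)
  · exact fun t ht => HasDerivAt.fun_sum fun x _ => (hu.eqn (N + x) t ht).const_mul _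
  · intro t ht
    have hnn : ∀ x, 0 ≤ u x t := fun x => hu.nonneg x t (Ioo_subset_Ico_self ht)
    have hJ := Real.rpow_arith_mean_le_arith_mean_rpow s (fun x => tent L x / S)
      (fun x => u (N + x) t) hw0 hw1 (fun x _ => hnn _) hp.le
    have hLap := neg_mul_sum_tent_le hL (u := fun x => u (N + x) t) fun x => hnn _
    have hz : ∀ x, zLap (fun y => u (N + y) t) x = zLap (fun y => u y t) (N + x) := by
      intro x
      simp only [zLap, add_assoc, add_sub_assoc]
    simp only [hz, ← hs] at hLap
    have hLap' := div_le_div_of_nonneg_right hLap hSpos.le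
    rw [mul_div_assoc, Finset.sum_div, Finset.sum_div] at hLap'
    simp only [mul_add, Finset.sum_add_distrib, div_mul_eq_mul_div] at hJ ⊢
    rw [neg_mul, div_mul_eq_mul_div] at hLap'
    linarith
  · calc c = ∑ x ∈ s, tent L x / S * c := by rw [← Finset.sum_mul, hw1, one_mul]
      _ ≤ _ := Finset.sum_le_sum fun x hx => by
        rw [hu.init]
        exact mul_le_mul_of_nonneg_left (hN x hx) (hw0 x hx)

lemma exists_interval_of_lt_max_liminf {ψ : ℤ → ℝ} (hψ0 : ∀ x, 0 ≤ ψ x) {c : ℝ}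
    (hc : c < max (liminf ψ atTop) (liminf ψ atBot)) (L : ℕ) :
    ∃ N : ℤ, ∀ x ∈ Finset.Icc (-(L : ℤ)) L, c ≤ ψ (N + x) := by
  rcases lt_max_iff.1 hc with h | h
  · obtain ⟨M, hM⟩ := eventually_atTop.1
      (eventually_lt_of_lt_liminf h (isBoundedUnder_of ⟨0, hψ0⟩))
    refine ⟨M + L, fun x hx => (hM _ ?_).le⟩
    have := Finset.mem_Icc.1 hx
    omega
  · obtain ⟨M, hM⟩ := eventually_atBot.1
      (eventually_lt_of_lt_liminf h (isBoundedUnder_of ⟨0, hψ0⟩))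
    refine ⟨M - L, fun x hx => (hM _ ?_).le⟩
    have := Finset.mem_Icc.1 hx
    omega

/-- Theorem 1.8: for the equation `u_t = Δ_ℤ u + u^p` on `ℤ` with bounded
initial datum `ψ ≥ 0`, `ψ ≢ 0`, if
`max{liminf_{x→+∞} ψ(x), liminf_{x→−∞} ψ(x)} > 0`, then the solution blows up
in finite time and
`T₁ ≤ (1/(p-1)) (max{liminf_{x→+∞} ψ, liminf_{x→−∞} ψ})^{1-p}`. -/
theorem stmt8 (p : ℝ) (hp : 1 < p)
    (ψ : ℤ → ℝ) (hψ0 : ∀ x, 0 ≤ ψ x) (hψbd : ∃ C : ℝ, ∀ x, ψ x ≤ C)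
    (hψne : ∃ x, ψ x ≠ 0)
    (hpos : 0 < max (liminf ψ atTop) (liminf ψ atBot)) :
    lifeSpan zLap p ψ < ⊤ ∧
      lifeSpan zLap p ψ ≤
        ENNReal.ofReal
          (1 / (p - 1) * max (liminf ψ atTop) (liminf ψ atBot) ^ (1 - p)) := by
  suffices h : lifeSpan zLap p ψ ≤ ENNReal.ofReal
      (1 / (p - 1) * max (liminf ψ atTop) (liminf ψ atBot) ^ (1 - p)) from
    ⟨h.trans_lt ENNReal.ofReal_lt_top, h⟩
  refine iSup₂_le fun T hT => ENNReal.ofReal_le_ofReal ?_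
  obtain ⟨hT, u, hu⟩ := hT
  set m := max (liminf ψ atTop) (liminf ψ atBot) with hm
  have hc : ∀ c ∈ Ioo 0 m, T * (p - 1) ≤ c ^ (1 - p) := by
    intro c hc
    have hlim : Tendsto (fun L : ℕ => Real.exp (2 / L * (p - 1) * T) * c ^ (1 - p)) atTop
        (𝓝 (Real.exp (0 * (p - 1) * T) * c ^ (1 - p))) :=
      ((Real.continuous_exp.tendsto _).comp
        (((tendsto_const_div_atTop_nhds_zero_nat 2).mul_const _).mul_const _)).mul_const _
    rw [zero_mul, zero_mul, Real.exp_zero, one_mul] at hlim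
    refine ge_of_tendsto hlim ?_
    filter_upwards [eventually_gt_atTop 0] with L hL
    obtain ⟨N, hN⟩ := exists_interval_of_lt_max_liminf hψ0 hc.2 L
    exact hu.mul_le_of_le_init hp hc.1 hT hL hN
  have hfin : T * (p - 1) ≤ m ^ (1 - p) := by
    have hlim : Tendsto (fun c : ℝ => c ^ (1 - p)) (𝓝[<] m) (𝓝 (m ^ (1 - p))) :=
      (Real.continuousAt_rpow_const m (1 - p) (Or.inl hpos.ne')).tendsto.mono_left
        nhdsWithin_le_nhds
    refine ge_of_tendsto hlim ?_
    filter_upwards [Ioo_mem_nhdsLT hpos] with c hcm using hc c hcm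
  rw [one_div, inv_mul_eq_div, le_div_iff₀ (by linarith)]
  exact hfin
end
end

section
/- Let G=(V,E,ω,μ) be a locally finite connected weighted graph, let Ω⊂V be a finite connected subset with nonempty interior Ω° = Ω∖∂Ω, let t₀ < T, and let c:(Ω°)×(t₀,T]→ℝ satisfy c(x,t) < 0 there. Suppose v:Ω×[t₀,T]→ℝ is differentiable in t and satisfies v_t − Δv − c(x,t)v ≥ 0 on Ω°×(t₀,T]. If min_{Ω×[t₀,T]} v < 0, then v does not attain this negative minimum at any point of Ω°×(t₀,T]. -/
open Filter Topology Set
open scoped ENNReal Classical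

noncomputable section

/-- There is a path with `n` edges from `x` to `y`. -/
def ReachesIn {V : Type*} (ω : V → V → ℝ) (n : ℕ) (x y : V) : Prop :=
  ∃ f : ℕ → V, f 0 = x ∧ f n = y ∧ ∀ i < n, 0 < ω (f i) (f (i + 1))

/-- The graph distance: the least number of edges of a path joining `x` and `y`. -/
def graphDist {V : Type*} (ω : V → V → ℝ) (x y : V) : ℕ :=
  sInf {n : ℕ | ReachesIn ω n x y}

/-- The interior `Ω° = Ω ∖ ∂Ω` of a finite vertex set `Ω`. -/
def finInterior {V : Type*} (ω : V → V → ℝ) (Ω : Finset V) : Set V :=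
  {x | x ∈ Ω ∧ ∀ y, 0 < ω x y → y ∈ Ω}

/-- `Ω` is connected as a subgraph. -/
def FinsetConnected {V : Type*} (ω : V → V → ℝ) (Ω : Finset V) : Prop :=
  ∀ x ∈ Ω, ∀ y ∈ Ω, Relation.ReflTransGen (fun a b => a ∈ Ω ∧ b ∈ Ω ∧ 0 < ω a b) x y

/-- The smallest eigenvalue `λ₁(Ω)` of the Dirichlet eigenvalue problem
`-Δ_Ω φ = λ φ` on `Ω°`, `φ = 0` on `∂Ω` (eigenfunctions are extended by zero
outside `Ω°`, so that `Δ_Ω` agrees with the graph Laplacian on `Ω°`). -/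
def lambdaOne {V : Type*} (ω : V → V → ℝ) (μ : V → ℝ) (Ω : Finset V) : ℝ :=
  sInf {l : ℝ | ∃ φ : V → ℝ, φ ≠ 0 ∧ (∀ x, x ∉ finInterior ω Ω → φ x = 0) ∧
    ∀ x ∈ finInterior ω Ω, -graphLap ω μ φ x = l * φ x}

/-- The eigenvalue condition (EC) relative to the vertex `xt`: for all `ε, δ > 0`
there is a finite connected subset `Ω ⊆ V` with nonempty interior such that
`λ₁(Ω) < ε` and `d(x, xt) > δ` for all `x ∈ Ω`. -/
def EigenCond {V : Type*} (ω : V → V → ℝ) (μ : V → ℝ) (xt : V) : Prop :=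
  ∀ ε > (0:ℝ), ∀ δ : ℝ, 0 < δ → ∃ Ω : Finset V, FinsetConnected ω Ω ∧
    (finInterior ω Ω).Nonempty ∧ lambdaOne ω μ Ω < ε ∧
    ∀ x ∈ Ω, δ < (graphDist ω xt x : ℝ)

/-- The Laplacian is nonnegative at a vertex where `u` is minimal among the neighbours. -/
lemma graphLap_nonneg_of_forall_le {V : Type*} {ω : V → V → ℝ} {μ : V → ℝ}
    (hG : IsWeightedGraph ω μ) {u : V → ℝ} {x : V} (h : ∀ y, 0 < ω x y → u x ≤ u y) :
    0 ≤ graphLap ω μ u x := by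
  refine mul_nonneg (one_div_nonneg.2 (hG.measurePos x).le) (tsum_nonneg fun y => ?_)
  rcases (hG.nonneg x y).eq_or_lt with h0 | h0
  · simp [← h0]
  · exact mul_nonneg h0.le (sub_nonneg.2 (h y h0))

/-- At a minimum point other than the left endpoint of an interval, the derivative is
nonpositive. -/
lemma HasDerivWithinAt.nonpos_of_isMinOn_Icc {f : ℝ → ℝ} {f' a b t : ℝ}
    (hf : HasDerivWithinAt f f' (Icc a b) t) (ht : t ∈ Ioc a b)
    (hmin : IsMinOn f (Icc a b) t) : f' ≤ 0 := by
  have hcone : a - t ∈ posTangentConeAt (Icc a b) t :=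
    sub_mem_posTangentConeAt_of_segment_subset <|
      (convex_Icc a b).segment_subset ⟨ht.1.le, ht.2⟩ ⟨le_rfl, ht.1.le.trans ht.2⟩
  have h := hmin.localize.hasFDerivWithinAt_nonneg hf.hasFDerivWithinAt hcone
  simp at h
  nlinarith [ht.1]

/-- Lemma 3.1 (maximum principle): if `c < 0` on `Ω° × (t₀,T]` and `v` is
differentiable in `t` with `v_t − Δv − c v ≥ 0` on `Ω° × (t₀,T]`, then `v`
cannot attain a negative minimum over `Ω × [t₀,T]` at a point of
`Ω° × (t₀,T]`. -/
theorem stmt10 {V : Type*}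
    (ω : V → V → ℝ) (μ : V → ℝ) (hG : IsWeightedGraph ω μ)
    (Ω : Finset V) (hconn : FinsetConnected ω Ω)
    (hint : (finInterior ω Ω).Nonempty)
    (t₀ T : ℝ) (ht : t₀ < T)
    (c : V → ℝ → ℝ) (hc : ∀ x ∈ finInterior ω Ω, ∀ t ∈ Ioc t₀ T, c x t < 0)
    (v v' : V → ℝ → ℝ)
    (hderiv : ∀ x ∈ (Ω : Set V), ∀ t ∈ Icc t₀ T,
      HasDerivWithinAt (v x) (v' x t) (Icc t₀ T) t)
    (hineq : ∀ x ∈ finInterior ω Ω, ∀ t ∈ Ioc t₀ T,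
      0 ≤ v' x t - graphLap ω μ (fun y => v y t) x - c x t * v x t) :
    ¬ ∃ x ∈ finInterior ω Ω, ∃ t ∈ Ioc t₀ T,
      v x t < 0 ∧ ∀ y ∈ Ω, ∀ s ∈ Icc t₀ T, v x t ≤ v y s := by
  rintro ⟨x, hx, t, htm, hneg, hmin⟩
  have htd : v' x t ≤ 0 :=
    (hderiv x hx.1 t (Ioc_subset_Icc_self htm)).nonpos_of_isMinOn_Icc htm fun s hs =>
      hmin x hx.1 s hs
  have hlap : 0 ≤ graphLap ω μ (fun y => v y t) x :=
    graphLap_nonneg_of_forall_le hG fun y hy =>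
      hmin y (hx.2 y hy) t (Ioc_subset_Icc_self htm)
  linarith [hineq x hx t htm, mul_pos_of_neg_of_neg (hc x hx t htm) hneg]
end
end
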